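/- Let p ∈ [2, ∞) with conjugate exponent q = p/(p−1), let N be a norm on ℝ^d with dual norm N_*, let μ₀ be a Borel probability measure on ℝ^d with bounded support, and let j : ℝ^d × Θ → ℝ be such that for every θ ∈ Θ the map x ↦ j(x,θ) is twice continuously differentiable with operator norm of the Hessian D²_x j(x,θ) bounded by a constant C uniformly over all x ∈ ℝ^d and θ ∈ Θ. Then there exists a constant C′, depending only on C, d and N, such that for every θ ∈ Θ and every δ > 0: | sup_{π ∈ F_{μ₀,δ}} ∫ j(x̃,θ) dπ(x,x̃) − ∫ j(x,θ) dμ₀(x) − δ · ( ∫ N_*(∇_x j(x,θ))^q dμ₀(x) )^{1/q} | ≤ C′ δ². -/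

import Mathlib

open MeasureTheory Real
open scoped RealInnerProductSpace

namespace DistributionallyRobust

section Seminorm

variable {E : Type*} [NormedAddCommGroup E] [InnerProductSpace ℝ E] [FiniteDimensional ℝ E]

theorem continuous_seminorm (N : Seminorm ℝ E) : Continuous N :=
  N.convexOn.locallyLipschitz.continuous

theorem exists_norm_le_mul_seminorm (N : Seminorm ℝ E) (hN : ∀ x, N x = 0 → x = 0) :
    ∃ c : ℝ, 0 ≤ c ∧ ∀ x, ‖x‖ ≤ c * N x := by
  rcases (Metric.sphere (0 : E) 1).eq_empty_or_nonempty with h | h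
  · refine ⟨0, le_rfl, fun x => ?_⟩
    by_contra! hx
    have hx0 : ‖x‖ ≠ 0 := by linarith
    have : (‖x‖⁻¹ • x) ∈ Metric.sphere (0 : E) 1 := by
      simp [norm_smul, inv_mul_cancel₀ hx0]
    simp [h] at this
  · obtain ⟨x₀, hx₀, hmin⟩ :=
      (isCompact_sphere (0 : E) 1).exists_isMinOn h (continuous_seminorm N).continuousOn
    have hpos : 0 < N x₀ := by
      refine (apply_nonneg N x₀).lt_of_ne fun h0 => ?_
      have := hN x₀ h0.symm
      simp [this] at hx₀
    refine ⟨(N x₀)⁻¹, (inv_pos.2 hpos).le, fun x => ?_⟩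
    rcases eq_or_ne x 0 with rfl | hx
    · simp
    have hx0 : 0 < ‖x‖ := norm_pos_iff.2 hx
    have hmem : (‖x‖⁻¹ • x) ∈ Metric.sphere (0 : E) 1 := by
      simp [norm_smul, inv_mul_cancel₀ hx0.ne']
    have h1 : N x₀ ≤ ‖x‖⁻¹ * N x := by
      simpa [map_smul_eq_mul] using hmin hmem
    rw [← div_eq_inv_mul, le_div_iff₀ hpos]
    rw [← div_eq_inv_mul, le_div_iff₀ hx0] at h1
    linarith

/-- The dual norm `y ↦ sup {⟪y, x⟫ | N x ≤ 1}` of a function `N`. -/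
noncomputable def dualNorm (N : E → ℝ) (y : E) : ℝ := sSup {r : ℝ | ∃ x, N x ≤ 1 ∧ r = ⟪y, x⟫}

variable {N : Seminorm ℝ E}

theorem bddAbove_dualNorm (hN : ∀ x, N x = 0 → x = 0) (y : E) :
    BddAbove {r : ℝ | ∃ x, N x ≤ 1 ∧ r = ⟪y, x⟫} := by
  obtain ⟨c, hc, hcN⟩ := exists_norm_le_mul_seminorm N hN
  refine ⟨‖y‖ * c, ?_⟩
  rintro r ⟨x, hx, rfl⟩
  refine (real_inner_le_norm y x).trans ?_
  gcongr
  exact (hcN x).trans (mul_le_of_le_one_right hc hx)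

theorem inner_le_dualNorm (hN : ∀ x, N x = 0 → x = 0) (y : E) {x : E} (hx : N x ≤ 1) :
    ⟪y, x⟫ ≤ dualNorm N y :=
  le_csSup (bddAbove_dualNorm hN y) ⟨x, hx, rfl⟩

theorem dualNorm_nonneg (hN : ∀ x, N x = 0 → x = 0) (y : E) : 0 ≤ dualNorm N y := by
  simpa using inner_le_dualNorm hN y (x := 0) (by simp)

omit [FiniteDimensional ℝ E] in
theorem dualNorm_le {y : E} {a : ℝ} (h : ∀ x, N x ≤ 1 → ⟪y, x⟫ ≤ a) : dualNorm N y ≤ a := by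
  refine csSup_le ⟨0, 0, by simp, by simp⟩ ?_
  rintro r ⟨x, hx, rfl⟩
  exact h x hx

theorem inner_le_dualNorm_mul (hN : ∀ x, N x = 0 → x = 0) (y x : E) :
    ⟪y, x⟫ ≤ dualNorm N y * N x := by
  rcases (apply_nonneg N x).eq_or_lt with h0 | hpos
  · simp [hN x h0.symm]
  · have := inner_le_dualNorm hN y (x := (N x)⁻¹ • x)
      (by simp [map_smul_eq_mul, abs_of_pos hpos, inv_mul_cancel₀ hpos.ne'])
    rw [real_inner_smul_right, ← div_eq_inv_mul, div_le_iff₀ hpos] at this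
    exact this

theorem abs_inner_le_dualNorm_mul (hN : ∀ x, N x = 0 → x = 0) (y x : E) :
    |⟪y, x⟫| ≤ dualNorm N y * N x := by
  refine abs_le'.2 ⟨inner_le_dualNorm_mul hN y x, ?_⟩
  simpa [inner_neg_right] using inner_le_dualNorm_mul hN y (-x)

theorem continuous_dualNorm (hN : ∀ x, N x = 0 → x = 0) : Continuous (dualNorm N) := by
  suffices h : ConvexOn ℝ Set.univ (dualNorm N) from h.locallyLipschitz.continuous
  refine ⟨convex_univ, ?_⟩
  intro y _ z _ a b ha hb _
  refine dualNorm_le fun x hx => ?_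
  rw [inner_add_left, real_inner_smul_left, real_inner_smul_left, smul_eq_mul, smul_eq_mul]
  gcongr <;> exact inner_le_dualNorm hN _ hx

theorem exists_measurable_dualNorm_sub_le_inner [MeasurableSpace E] [BorelSpace E]
    (hN : ∀ x, N x = 0 → x = 0) {ε : ℝ} (hε : 0 < ε) :
    ∃ u : E → E, Measurable u ∧ (∀ y, N (u y) ≤ 1) ∧ ∀ y, dualNorm N y - ε ≤ ⟪y, u y⟫ := by
  classical
  have : Nonempty {x : E // N x ≤ 1} := ⟨⟨0, by simp⟩⟩
  let D := TopologicalSpace.denseSeq {x : E // N x ≤ 1}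
  have hex : ∀ y, ∃ n, dualNorm N y - ε < ⟪y, (D n : E)⟫ := by
    intro y
    have hne : {r : ℝ | ∃ x, N x ≤ 1 ∧ r = ⟪y, x⟫}.Nonempty := ⟨0, 0, by simp, by simp⟩
    obtain ⟨_, ⟨x, hx, rfl⟩, hr⟩ := exists_lt_of_lt_csSup hne (sub_lt_self (dualNorm N y) hε)
    have ho : IsOpen {x : {x : E // N x ≤ 1} | dualNorm N y - ε < ⟪y, (x : E)⟫} :=
      isOpen_lt continuous_const (by fun_prop)
    obtain ⟨_, hz, n, rfl⟩ :=
      (TopologicalSpace.denseRange_denseSeq {x : E // N x ≤ 1}).inter_open_nonempty _ ho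
        ⟨⟨x, hx⟩, hr⟩
    exact ⟨n, hz⟩
  have hm : ∀ n, MeasurableSet {y | dualNorm N y - ε < ⟪y, (D n : E)⟫} := fun n =>
    (isOpen_lt ((continuous_dualNorm hN).sub continuous_const) (by fun_prop)).measurableSet
  exact ⟨fun y => D (Nat.find (hex y)),
    Measurable.find (f := fun n _ => (D n : E)) (fun _ => measurable_const) hm hex,
    fun y => (D _).2, fun y => (Nat.find_spec (hex y)).le⟩

theorem abs_sub_sub_inner_gradient_le {f : E → ℝ} (hf : ContDiff ℝ 2 f) {C : ℝ}
    (hC : ∀ x, ‖iteratedFDeriv ℝ 2 f x‖ ≤ C) (x y : E) :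
    |f y - f x - ⟪gradient f x, y - x⟫| ≤ C * ‖y - x‖ ^ 2 := by
  have hC0 : 0 ≤ C := (norm_nonneg _).trans (hC x)
  have hf' : ContDiff ℝ 1 (fderiv ℝ f) := hf.fderiv_right (by norm_num)
  have hlip : ∀ z, ‖fderiv ℝ f z - fderiv ℝ f x‖ ≤ C * ‖z - x‖ := fun z =>
    convex_univ.norm_image_sub_le_of_norm_fderiv_le (𝕜 := ℝ)
      (fun w _ => hf'.differentiable one_ne_zero w)
      (fun w _ => by
        rw [← norm_iteratedFDeriv_one, norm_iteratedFDeriv_fderiv]; exact hC w)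
      (Set.mem_univ _) (Set.mem_univ _)
  have h := (convex_segment x y).norm_image_sub_le_of_norm_fderiv_le' (𝕜 := ℝ)
    (f := f) (φ := fderiv ℝ f x) (C := C * ‖y - x‖)
    (fun w _ => hf.differentiable two_ne_zero w)
    (fun w hw => (hlip w).trans (by
      gcongr
      simpa [norm_sub_rev] using norm_sub_le_of_mem_segment hw))
    (left_mem_segment ℝ x y) (right_mem_segment ℝ x y)
  have hg : ⟪gradient f x, y - x⟫ = fderiv ℝ f x (y - x) := by simp [gradient]
  rw [hg, ← Real.norm_eq_abs]
  calc _ ≤ _ := h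
    _ = _ := by ring

theorem continuous_gradient {f : E → ℝ} (hf : ContDiff ℝ 1 f) : Continuous (gradient f) :=
  (InnerProductSpace.toDual ℝ E).symm.continuous.comp (hf.continuous_fderiv one_ne_zero)

end Seminorm

section Measure

variable {E : Type*} [NormedAddCommGroup E] [InnerProductSpace ℝ E] [FiniteDimensional ℝ E]
  [MeasurableSpace E] [BorelSpace E]

omit [BorelSpace E] in
theorem ae_norm_le_of_continuous {F : Type*} [NormedAddCommGroup F] {μ : Measure E}
    (hμ : ∃ K : Set E, Bornology.IsBounded K ∧ μ Kᶜ = 0) {f : E → F} (hf : Continuous f) :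
    ∃ B : ℝ, ∀ᵐ x ∂μ, ‖f x‖ ≤ B := by
  obtain ⟨K, hK, hK0⟩ := hμ
  obtain ⟨B, hB⟩ := hK.isCompact_closure.exists_bound_of_continuousOn hf.continuousOn
  refine ⟨B, ?_⟩
  filter_upwards [show ∀ᵐ x ∂μ, x ∈ K from hK0] with x hx
  exact hB x (subset_closure hx)

theorem memLp_of_continuous {μ : Measure E} [IsFiniteMeasure μ]
    (hμ : ∃ K : Set E, Bornology.IsBounded K ∧ μ Kᶜ = 0) {f : E → ℝ} (hf : Continuous f)
    (p : ENNReal) : MemLp f p μ := by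
  obtain ⟨B, hB⟩ := ae_norm_le_of_continuous hμ hf
  exact MemLp.of_bound hf.aestronglyMeasurable B hB

theorem integrable_of_continuous {μ : Measure E} [IsFiniteMeasure μ]
    (hμ : ∃ K : Set E, Bornology.IsBounded K ∧ μ Kᶜ = 0) {f : E → ℝ} (hf : Continuous f) :
    Integrable f μ :=
  memLp_one_iff_integrable.1 (memLp_of_continuous hμ hf 1)

/-- The law of a pair `(x, y)` such that `x` has law `μ₀` and `E[N (y - x) ^ p] ≤ δ ^ p`. -/
structure IsFeasible (N : E → ℝ) (μ₀ : Measure E) (p δ : ℝ) (ν : Measure (E × E)) : Prop where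
  isProbabilityMeasure : IsProbabilityMeasure ν
  map_fst : ν.map Prod.fst = μ₀
  lintegral_le : ∫⁻ z, ENNReal.ofReal (N (z.2 - z.1) ^ p) ∂ν ≤ ENNReal.ofReal (δ ^ p)

namespace IsFeasible

variable {N : Seminorm ℝ E} {μ₀ : Measure E} {p q δ : ℝ} {ν : Measure (E × E)}

theorem integrable_rpow (h : IsFeasible N μ₀ p δ ν) (hp : 0 ≤ p) :
    Integrable (fun z => N (z.2 - z.1) ^ p) ν := by
  have hc := continuous_seminorm N
  refine ⟨(Continuous.rpow_const (by fun_prop) fun _ => Or.inr hp).aestronglyMeasurable, ?_⟩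
  rw [hasFiniteIntegral_iff_ofReal
    (Filter.Eventually.of_forall fun z => Real.rpow_nonneg (apply_nonneg N _) p)]
  exact h.lintegral_le.trans_lt ENNReal.ofReal_lt_top

theorem integral_rpow_le (h : IsFeasible N μ₀ p δ ν) (hp : 0 ≤ p) (hδ : 0 ≤ δ) :
    ∫ z, N (z.2 - z.1) ^ p ∂ν ≤ δ ^ p := by
  rw [← ENNReal.ofReal_le_ofReal_iff (Real.rpow_nonneg hδ p),
    ofReal_integral_eq_lintegral_ofReal (h.integrable_rpow hp)
      (Filter.Eventually.of_forall fun z => Real.rpow_nonneg (apply_nonneg N _) p)]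
  exact h.lintegral_le

theorem memLp (h : IsFeasible N μ₀ p δ ν) (hp : 0 < p) :
    MemLp (fun z => N (z.2 - z.1)) (ENNReal.ofReal p) ν := by
  have hc := continuous_seminorm N
  rw [← integrable_norm_rpow_iff
    (Continuous.aestronglyMeasurable (by fun_prop)) (by simpa using hp) (by simp),
    ENNReal.toReal_ofReal hp.le]
  simpa [abs_of_nonneg (apply_nonneg N _)] using h.integrable_rpow hp.le

theorem integrable_sq (h : IsFeasible N μ₀ p δ ν) (hp : 2 ≤ p) :
    Integrable (fun z => N (z.2 - z.1) ^ 2) ν := by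
  have := h.isProbabilityMeasure
  refine ((h.memLp (by linarith)).mono_exponent ?_).integrable_sq
  simpa using ENNReal.ofReal_le_ofReal hp

theorem integral_sq_le (h : IsFeasible N μ₀ p δ ν) (hp : 2 ≤ p) (hδ : 0 < δ) :
    ∫ z, N (z.2 - z.1) ^ 2 ∂ν ≤ δ ^ 2 := by
  have := h.isProbabilityMeasure
  have hp0 : 0 < p := by linarith
  have hpt : ∀ z : E × E, N (z.2 - z.1) ^ 2 ≤
      δ ^ 2 * (2 / p * (N (z.2 - z.1) ^ p / δ ^ p) + (1 - 2 / p)) := by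
    intro z
    set a := N (z.2 - z.1)
    have ha : 0 ≤ a := apply_nonneg N _
    have hy := Real.geom_mean_le_arith_mean2_weighted (w₁ := 2 / p) (w₂ := 1 - 2 / p)
      (p₁ := (a / δ) ^ p) (p₂ := 1) (by positivity)
      (by rw [sub_nonneg, div_le_one hp0]; exact hp) (by positivity) zero_le_one (by ring)
    rw [Real.one_rpow, mul_one, mul_one, ← Real.rpow_mul (by positivity),
      mul_div_cancel₀ _ hp0.ne', Real.rpow_two, Real.div_rpow ha hδ.le, div_pow,
      div_le_iff₀ (by positivity)] at hy
    linarith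
  have hi := h.integrable_rpow hp0.le
  have hpδ : 0 < δ ^ p := Real.rpow_pos_of_pos hδ p
  have hle := (div_le_one hpδ).2 (h.integral_rpow_le hp0.le hδ.le)
  calc ∫ z, N (z.2 - z.1) ^ 2 ∂ν
      ≤ ∫ z, δ ^ 2 * (2 / p * (N (z.2 - z.1) ^ p / δ ^ p) + (1 - 2 / p)) ∂ν :=
        integral_mono (h.integrable_sq hp)
          ((((hi.div_const _).const_mul _).add (integrable_const _)).const_mul _) hpt
    _ = δ ^ 2 * (2 / p * ((∫ z, N (z.2 - z.1) ^ p ∂ν) / δ ^ p) + (1 - 2 / p)) := by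
        rw [integral_const_mul, integral_add ((hi.div_const _).const_mul _) (integrable_const _),
          integral_const_mul, integral_div]
        simp
    _ ≤ δ ^ 2 * (2 / p * 1 + (1 - 2 / p)) := by gcongr
    _ = δ ^ 2 := by ring

omit [FiniteDimensional ℝ E] [BorelSpace E] in
theorem integrable_comp_fst (h : IsFeasible N μ₀ p δ ν) {f : E → ℝ} (hf : Integrable f μ₀) :
    Integrable (fun z => f z.1) ν := by
  rw [← h.map_fst] at hf
  exact (integrable_map_measure hf.1 measurable_fst.aemeasurable).1 hf

omit [FiniteDimensional ℝ E] [BorelSpace E] in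
theorem integral_comp_fst (h : IsFeasible N μ₀ p δ ν) {f : E → ℝ}
    (hf : AEStronglyMeasurable f μ₀) : ∫ z, f z.1 ∂ν = ∫ x, f x ∂μ₀ := by
  rw [← h.map_fst] at hf ⊢
  exact (integral_map measurable_fst.aemeasurable hf).symm

omit [FiniteDimensional ℝ E] [BorelSpace E] in
theorem memLp_comp_fst (h : IsFeasible N μ₀ p δ ν) {f : E → ℝ} {r : ENNReal}
    (hf : MemLp f r μ₀) : MemLp (fun z => f z.1) r ν := by
  rw [← h.map_fst] at hf
  exact (memLp_map_measure_iff hf.1 measurable_fst.aemeasurable).1 hf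

section Gradient

variable [IsProbabilityMeasure μ₀] {g : E → E}

theorem integrable_dualNorm_mul (h : IsFeasible N μ₀ p δ ν) (hN : ∀ x, N x = 0 → x = 0)
    (hμ₀ : ∃ K : Set E, Bornology.IsBounded K ∧ μ₀ Kᶜ = 0) (hpq : p.HolderConjugate q)
    (hg : Continuous g) :
    Integrable (fun z => dualNorm N (g z.1) * N (z.2 - z.1)) ν := by
  have := hpq.ennrealOfReal
  exact (h.memLp hpq.pos).integrable_mul
    (h.memLp_comp_fst (memLp_of_continuous hμ₀ ((continuous_dualNorm hN).comp hg)
      (ENNReal.ofReal q))) |>.congr (Filter.Eventually.of_forall fun z => mul_comm _ _)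

theorem integrable_inner (h : IsFeasible N μ₀ p δ ν) (hN : ∀ x, N x = 0 → x = 0)
    (hμ₀ : ∃ K : Set E, Bornology.IsBounded K ∧ μ₀ Kᶜ = 0) (hpq : p.HolderConjugate q)
    (hg : Continuous g) :
    Integrable (fun z => ⟪g z.1, z.2 - z.1⟫) ν :=
  (h.integrable_dualNorm_mul hN hμ₀ hpq hg).mono'
    (Continuous.aestronglyMeasurable (by fun_prop))
    (Filter.Eventually.of_forall fun z => abs_inner_le_dualNorm_mul hN _ _)

theorem integral_inner_le (h : IsFeasible N μ₀ p δ ν) (hN : ∀ x, N x = 0 → x = 0)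
    (hμ₀ : ∃ K : Set E, Bornology.IsBounded K ∧ μ₀ Kᶜ = 0) (hpq : p.HolderConjugate q)
    (hδ : 0 < δ) (hg : Continuous g) :
    ∫ z, ⟪g z.1, z.2 - z.1⟫ ∂ν ≤ δ * (∫ x, dualNorm N (g x) ^ q ∂μ₀) ^ (1 / q) := by
  have hG : Continuous fun x => dualNorm N (g x) := (continuous_dualNorm hN).comp hg
  have hq : Continuous fun x => dualNorm N (g x) ^ q :=
    hG.rpow_const fun _ => Or.inr hpq.symm.nonneg
  calc ∫ z, ⟪g z.1, z.2 - z.1⟫ ∂ν ≤ ∫ z, N (z.2 - z.1) * dualNorm N (g z.1) ∂ν :=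
        integral_mono (h.integrable_inner hN hμ₀ hpq hg)
          ((h.integrable_dualNorm_mul hN hμ₀ hpq hg).congr
            (Filter.Eventually.of_forall fun z => mul_comm _ _))
          fun z => (inner_le_dualNorm_mul hN _ _).trans_eq (mul_comm _ _)
    _ ≤ (∫ z, N (z.2 - z.1) ^ p ∂ν) ^ (1 / p) * (∫ z, dualNorm N (g z.1) ^ q ∂ν) ^ (1 / q) :=
        integral_mul_le_Lp_mul_Lq_of_nonneg hpq
          (Filter.Eventually.of_forall fun z => apply_nonneg N _)
          (Filter.Eventually.of_forall fun z => dualNorm_nonneg hN _) (h.memLp hpq.pos)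
          (h.memLp_comp_fst (memLp_of_continuous hμ₀ hG _))
    _ ≤ (δ ^ p) ^ (1 / p) * (∫ x, dualNorm N (g x) ^ q ∂μ₀) ^ (1 / q) := by
        rw [h.integral_comp_fst (f := fun x => dualNorm N (g x) ^ q) hq.aestronglyMeasurable]
        have h0 : 0 ≤ ∫ z, N (z.2 - z.1) ^ p ∂ν :=
          integral_nonneg fun z => Real.rpow_nonneg (apply_nonneg N _) p
        have h1 : 0 ≤ ∫ x, dualNorm N (g x) ^ q ∂μ₀ :=
          integral_nonneg fun z => Real.rpow_nonneg (dualNorm_nonneg hN _) q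
        have hp1 : 0 ≤ 1 / p := one_div_nonneg.2 hpq.nonneg
        gcongr
        exact h.integral_rpow_le hpq.nonneg hδ.le
    _ = δ * (∫ x, dualNorm N (g x) ^ q ∂μ₀) ^ (1 / q) := by
        rw [← Real.rpow_mul hδ.le, mul_one_div_cancel hpq.ne_zero, Real.rpow_one]

theorem abs_integral_sub_le (h : IsFeasible N μ₀ p δ ν) (hN : ∀ x, N x = 0 → x = 0)
    (hμ₀ : ∃ K : Set E, Bornology.IsBounded K ∧ μ₀ Kᶜ = 0) (hpq : p.HolderConjugate q)
    (hp : 2 ≤ p) (hδ : 0 < δ) {c : ℝ} (hc : ∀ x, ‖x‖ ≤ c * N x) {f : E → ℝ}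
    (hf : ContDiff ℝ 2 f) {C : ℝ} (hC : ∀ x, ‖iteratedFDeriv ℝ 2 f x‖ ≤ C) :
    |∫ z, f z.2 ∂ν - ∫ x, f x ∂μ₀ - ∫ z, ⟪gradient f z.1, z.2 - z.1⟫ ∂ν|
      ≤ C * c ^ 2 * δ ^ 2 := by
  have hC0 : 0 ≤ C := (norm_nonneg _).trans (hC 0)
  have hg : Continuous (gradient f) := continuous_gradient (hf.of_le one_le_two)
  have hf0 := hf.continuous
  have hi₁ := h.integrable_comp_fst (integrable_of_continuous hμ₀ hf0)
  have hi₂ := h.integrable_inner hN hμ₀ hpq hg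
  have hi₃ := (h.integrable_sq hp).const_mul (C * c ^ 2)
  have hR : ∀ z : E × E, ‖f z.2 - f z.1 - ⟪gradient f z.1, z.2 - z.1⟫‖ ≤
      C * c ^ 2 * N (z.2 - z.1) ^ 2 := fun z => by
    refine (abs_sub_sub_inner_gradient_le hf hC z.1 z.2).trans ?_
    rw [mul_assoc, ← mul_pow]
    gcongr
    exact hc _
  have hi₄ : Integrable (fun z : E × E => f z.2 - f z.1 - ⟪gradient f z.1, z.2 - z.1⟫) ν :=
    hi₃.mono' (Continuous.aestronglyMeasurable (by fun_prop)) (Filter.Eventually.of_forall hR)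
  have hi₅ : Integrable (fun z : E × E => f z.2) ν :=
    ((hi₄.add hi₂).add hi₁).congr (Filter.Eventually.of_forall fun z => by simp)
  have hi₆ : Integrable (fun z : E × E => f z.2 - f z.1) ν := hi₅.sub hi₁
  rw [← h.integral_comp_fst hf0.aestronglyMeasurable, ← integral_sub hi₅ hi₁,
    ← integral_sub hi₆ hi₂, ← Real.norm_eq_abs]
  calc _ ≤ ∫ z, C * c ^ 2 * N (z.2 - z.1) ^ 2 ∂ν :=
        norm_integral_le_of_norm_le hi₃ (Filter.Eventually.of_forall hR)
    _ ≤ _ := by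
        rw [integral_const_mul]
        have := h.integral_sq_le hp hδ
        gcongr

end Gradient

end IsFeasible

theorem exists_isFeasible_le_integral_inner {N : Seminorm ℝ E} {μ₀ : Measure E}
    [IsProbabilityMeasure μ₀] {p q δ : ℝ} {g : E → E} (hN : ∀ x, N x = 0 → x = 0)
    (hμ₀ : ∃ K : Set E, Bornology.IsBounded K ∧ μ₀ Kᶜ = 0) (hpq : p.HolderConjugate q)
    (hδ : 0 < δ) (hg : Continuous g) {η : ℝ} (hη : 0 < η) :
    ∃ ν, IsFeasible N μ₀ p δ ν ∧
      δ * (∫ x, dualNorm N (g x) ^ q ∂μ₀) ^ (1 / q) - η ≤ ∫ z, ⟪g z.1, z.2 - z.1⟫ ∂ν := by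
  set A := ∫ x, dualNorm N (g x) ^ q ∂μ₀
  let G : E → ℝ := fun x => dualNorm N (g x)
  have hG0 : ∀ x, 0 ≤ G x := fun x => dualNorm_nonneg hN _
  have hG : Continuous G := (continuous_dualNorm hN).comp hg
  have hGq : Integrable (fun x => G x ^ q) μ₀ :=
    integrable_of_continuous hμ₀ (hG.rpow_const fun _ => Or.inr hpq.symm.nonneg)
  have hA : 0 ≤ A := integral_nonneg fun x => Real.rpow_nonneg (hG0 x) q
  let l : E → ℝ := fun x => δ * (G x ^ (q - 1) / A ^ (1 / p))
  have hl : Continuous l :=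
    ((hG.rpow_const fun _ => Or.inr hpq.symm.sub_one_pos.le).div_const _).const_mul δ
  have hl0 : ∀ x, 0 ≤ l x := fun x =>
    mul_nonneg hδ.le (div_nonneg (Real.rpow_nonneg (hG0 x) _) (Real.rpow_nonneg hA _))
  have hli := integrable_of_continuous hμ₀ hl
  have hL : 0 ≤ ∫ x, l x ∂μ₀ := integral_nonneg hl0
  have hlp : ∀ x, l x ^ p = δ ^ p / A * G x ^ q := fun x => by
    have hqp : (q - 1) * p = q := hpq.symm.sub_one_mul_conj
    rw [Real.mul_rpow hδ.le (div_nonneg (Real.rpow_nonneg (hG0 x) _) (Real.rpow_nonneg hA _)),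
      Real.div_rpow (Real.rpow_nonneg (hG0 x) _) (Real.rpow_nonneg hA _),
      ← Real.rpow_mul (hG0 x), ← Real.rpow_mul hA, hqp, one_div_mul_cancel hpq.ne_zero,
      Real.rpow_one]
    ring
  have hlG : ∀ x, l x * G x = δ / A ^ (1 / p) * G x ^ q := fun x => by
    have : G x ^ (q - 1) * G x = G x ^ q := by
      rw [← Real.rpow_add_one' (hG0 x) (by simpa using hpq.symm.ne_zero), sub_add_cancel]
    rw [← this]
    ring
  have hAq : A / A ^ (1 / p) = A ^ (1 / q) := by
    rcases hA.eq_or_lt with h0 | h0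
    · rw [← h0, zero_div, Real.zero_rpow (one_div_ne_zero hpq.symm.ne_zero)]
    · rw [div_eq_iff (Real.rpow_pos_of_pos h0 _).ne', ← Real.rpow_add h0, add_comm,
        one_div, one_div, hpq.inv_add_inv_eq_one, Real.rpow_one]
  obtain ⟨u, hum, huN, hu⟩ := exists_measurable_dualNorm_sub_le_inner hN
    (show 0 < η / (∫ x, l x ∂μ₀ + 1) by positivity)
  set ε := η / (∫ x, l x ∂μ₀ + 1)
  have hT : Measurable fun x => (x, x + l x • u (g x)) := by
    have := hl.measurable
    have := hum.comp hg.measurable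
    fun_prop
  have hNc := continuous_seminorm N
  have hν : IsFeasible N μ₀ p δ (μ₀.map fun x => (x, x + l x • u (g x))) := by
    refine ⟨Measure.isProbabilityMeasure_map hT.aemeasurable, ?_, ?_⟩
    · rw [Measure.map_map measurable_fst hT]
      exact Measure.map_id
    · rw [lintegral_map (Measurable.ennreal_ofReal (by fun_prop)) hT]
      calc _ ≤ ∫⁻ x, ENNReal.ofReal (δ ^ p / A * G x ^ q) ∂μ₀ := by
            refine lintegral_mono fun x => ENNReal.ofReal_le_ofReal ?_
            rw [← hlp]
            refine Real.rpow_le_rpow (apply_nonneg N _) ?_ hpq.nonneg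
            rw [add_sub_cancel_left, map_smul_eq_mul, Real.norm_of_nonneg (hl0 x)]
            exact mul_le_of_le_one_right (hl0 x) (huN _)
        _ = ENNReal.ofReal (∫ x, δ ^ p / A * G x ^ q ∂μ₀) := by
            refine (ofReal_integral_eq_lintegral_ofReal (hGq.const_mul _)
              (Filter.Eventually.of_forall fun x => ?_)).symm
            exact mul_nonneg (div_nonneg (Real.rpow_nonneg hδ.le p) hA)
              (Real.rpow_nonneg (hG0 x) q)
        _ ≤ ENNReal.ofReal (δ ^ p) := by
            refine ENNReal.ofReal_le_ofReal ?_
            rw [integral_const_mul, div_mul_eq_mul_div, mul_div_assoc]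
            exact mul_le_of_le_one_right (Real.rpow_nonneg hδ.le p) (div_self_le_one A)
  refine ⟨_, hν, ?_⟩
  have hi := hν.integrable_inner hN hμ₀ hpq hg
  have hcont : Continuous fun z : E × E => ⟪g z.1, z.2 - z.1⟫ := by fun_prop
  rw [integrable_map_measure hcont.aestronglyMeasurable hT.aemeasurable] at hi
  rw [integral_map hT.aemeasurable hcont.aestronglyMeasurable]
  calc δ * A ^ (1 / q) - η ≤ δ * A ^ (1 / q) - ε * ∫ x, l x ∂μ₀ := by
        gcongr
        rw [div_mul_eq_mul_div, div_le_iff₀ (by positivity)]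
        gcongr
        linarith
    _ = ∫ x, (δ / A ^ (1 / p) * G x ^ q - ε * l x) ∂μ₀ := by
        have h₁ : ∫ x, δ / A ^ (1 / p) * G x ^ q ∂μ₀ = δ / A ^ (1 / p) * A :=
          integral_const_mul _ _
        have h₂ : ∫ x, ε * l x ∂μ₀ = ε * ∫ x, l x ∂μ₀ := integral_const_mul _ _
        rw [integral_sub (hGq.const_mul _) (hli.const_mul _), h₁, h₂, ← hAq]
        ring
    _ ≤ _ := by
        refine integral_mono ((hGq.const_mul _).sub (hli.const_mul _)) hi fun x => ?_
        rw [← hlG]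
        simp only [add_sub_cancel_left, real_inner_smul_right]
        calc l x * G x - ε * l x = l x * (G x - ε) := by ring
          _ ≤ _ := mul_le_mul_of_nonneg_left (hu (g x)) (hl0 x)

theorem abs_sSup_sub_sub_le {N : Seminorm ℝ E} {μ₀ : Measure E} [IsProbabilityMeasure μ₀]
    {p q δ : ℝ} (hN : ∀ x, N x = 0 → x = 0)
    (hμ₀ : ∃ K : Set E, Bornology.IsBounded K ∧ μ₀ Kᶜ = 0) (hpq : p.HolderConjugate q)
    (hp : 2 ≤ p) (hδ : 0 < δ) {c : ℝ} (hc : ∀ x, ‖x‖ ≤ c * N x) {f : E → ℝ}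
    (hf : ContDiff ℝ 2 f) {C : ℝ} (hC : ∀ x, ‖iteratedFDeriv ℝ 2 f x‖ ≤ C) :
    |sSup {r : ℝ | ∃ ν, IsFeasible N μ₀ p δ ν ∧ r = ∫ z, f z.2 ∂ν} - ∫ x, f x ∂μ₀
        - δ * (∫ x, dualNorm N (gradient f x) ^ q ∂μ₀) ^ (1 / q)| ≤ C * c ^ 2 * δ ^ 2 := by
  have hg : Continuous (gradient f) := continuous_gradient (hf.of_le one_le_two)
  have hub : ∀ r ∈ {r : ℝ | ∃ ν, IsFeasible N μ₀ p δ ν ∧ r = ∫ z, f z.2 ∂ν},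
      r ≤ ∫ x, f x ∂μ₀ + δ * (∫ x, dualNorm N (gradient f x) ^ q ∂μ₀) ^ (1 / q)
        + C * c ^ 2 * δ ^ 2 := by
    rintro r ⟨ν, hν, rfl⟩
    have h₁ := (abs_le.1 (hν.abs_integral_sub_le hN hμ₀ hpq hp hδ hc hf hC)).2
    have h₂ := hν.integral_inner_le hN hμ₀ hpq hδ hg
    linarith
  refine abs_le.2 ⟨?_, ?_⟩
  · refine le_of_forall_pos_le_add fun η hη => ?_
    obtain ⟨ν, hν, hle⟩ := exists_isFeasible_le_integral_inner hN hμ₀ hpq hδ hg hη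
    have h₁ := (abs_le.1 (hν.abs_integral_sub_le hN hμ₀ hpq hp hδ hc hf hC)).1
    have h₂ := le_csSup ⟨_, hub⟩ ⟨ν, hν, rfl⟩
    linarith
  · obtain ⟨ν, hν, -⟩ := exists_isFeasible_le_integral_inner hN hμ₀ hpq hδ hg one_pos
    have hne : {r : ℝ | ∃ ν, IsFeasible N μ₀ p δ ν ∧ r = ∫ z, f z.2 ∂ν}.Nonempty :=
      ⟨_, ν, hν, rfl⟩
    have := csSup_le hne hub
    linarith

end Measure

end DistributionallyRobust

/-- **First-order regularization of distributionally robust learning** (Theorem 2.1, first part).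
For `p ∈ [2,∞)` with conjugate `q`, a norm `N` on `ℝ^d` with dual norm `Nstar`, a compactly
(boundedly) supported probability measure `μ₀`, and a loss `j` that is `C²` in `x` with Hessian
bounded by `C` uniformly in `x` and `θ`, the robust objective
`sup_{ν ∈ F_{μ₀,δ}} ∫ j(x̃,θ) dν` equals
`∫ j dμ₀ + δ (∫ Nstar(∇_x j)^q dμ₀)^{1/q} + O(δ²)` uniformly in `θ`,
with the constant in `O(δ²)` depending only on `C`, `d` and `N`. -/
theorem stmt_0
    {d : ℕ} {Θ : Type*}
    (p q : ℝ) (hp : 2 ≤ p) (hq : q = p / (p - 1))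
    (N Nstar : EuclideanSpace ℝ (Fin d) → ℝ)
    (hN0 : ∀ x, N x = 0 ↔ x = 0)
    (hNsmul : ∀ (a : ℝ) (x : EuclideanSpace ℝ (Fin d)), N (a • x) = |a| * N x)
    (hNadd : ∀ x y, N (x + y) ≤ N x + N y)
    (hNstar : ∀ y, Nstar y = sSup {r : ℝ | ∃ x, N x ≤ 1 ∧ r = ⟪y, x⟫})
    (C : ℝ) :
    ∃ C' : ℝ,
      ∀ (μ₀ : Measure (EuclideanSpace ℝ (Fin d))), IsProbabilityMeasure μ₀ →
      (∃ K : Set (EuclideanSpace ℝ (Fin d)), Bornology.IsBounded K ∧ μ₀ Kᶜ = 0) →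
      ∀ (j : EuclideanSpace ℝ (Fin d) → Θ → ℝ),
      (∀ θ, ContDiff ℝ 2 (fun x => j x θ)) →
      (∀ θ x, ‖iteratedFDeriv ℝ 2 (fun y => j y θ) x‖ ≤ C) →
      ∀ (θ : Θ) (δ : ℝ), 0 < δ →
      |sSup {r : ℝ |
          ∃ ν : Measure (EuclideanSpace ℝ (Fin d) × EuclideanSpace ℝ (Fin d)),
            IsProbabilityMeasure ν ∧ ν.map Prod.fst = μ₀ ∧
            (∫⁻ z, ENNReal.ofReal (N (z.2 - z.1) ^ p) ∂ν) ≤ ENNReal.ofReal (δ ^ p) ∧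
            r = ∫ z, j z.2 θ ∂ν}
        - ∫ x, j x θ ∂μ₀
        - δ * (∫ x, Nstar (gradient (fun y => j y θ) x) ^ q ∂μ₀) ^ (1 / q)|
      ≤ C' * δ ^ 2 := by
  obtain rfl : Nstar = DistributionallyRobust.dualNorm N := funext hNstar
  let M : Seminorm ℝ (EuclideanSpace ℝ (Fin d)) := Seminorm.of N hNadd hNsmul
  have hM : ∀ x, M x = 0 → x = 0 := fun x => (hN0 x).1
  have hpq : p.HolderConjugate q := by
    rw [Real.holderConjugate_iff_eq_conjExponent (by linarith)]
    exact hq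
  obtain ⟨c, -, hc⟩ := DistributionallyRobust.exists_norm_le_mul_seminorm M hM
  refine ⟨C * c ^ 2, fun μ₀ _ hμ₀ j hj hjC θ δ hδ => ?_⟩
  convert DistributionallyRobust.abs_sSup_sub_sub_le hM hμ₀ hpq hp hδ hc (hj θ) (hjC θ) using 5
  · congr 1
    ext r
    exact ⟨fun ⟨ν, h₁, h₂, h₃, h₄⟩ => ⟨ν, ⟨h₁, h₂, h₃⟩, h₄⟩,
      fun ⟨ν, ⟨h₁, h₂, h₃⟩, h₄⟩ => ⟨ν, h₁, h₂, h₃, h₄⟩⟩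
  · rfl
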